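/- arXiv:1805.10005 — 7 statements merged into one kernel-verified Lean document; each statement's English description precedes it below -/
import Mathlib

section
/- Let Φ be an N×D real matrix with rank Φ = D (full column rank), let 1 ≤ d ≤ D, and let μ : Fin N → ℝ be a probability vector with μ(x) > 0 for all x, with D_μ the diagonal matrix with diagonal entries μ(x). With respect to the product Gaussian measure on d×D random matrices H with i.i.d. N(0, 1/d) entries, almost surely the d×d matrix Ψᵀ D_μ Ψ is invertible, where Ψ = Φ · Hᵀ. -/
open MeasureTheory ProbabilityTheory Matrix

/-- A nonzero real polynomial in `n` variables vanishes almost nowhere for any product of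
`σ`-finite atomless measures. -/
lemma MvPolynomial.ae_eval_ne_zero_fin {n : ℕ} (ν : Fin n → Measure ℝ)
    [∀ i, SigmaFinite (ν i)] [∀ i, NullSingletonClass (ν i)]
    {p : MvPolynomial (Fin n) ℝ} (hp : p ≠ 0) :
    ∀ᵐ x ∂Measure.pi ν, MvPolynomial.eval x p ≠ 0 := by
  induction n with
  | zero =>
    refine .of_forall fun x hx => hp ?_
    exact MvPolynomial.funext fun y => by rw [Subsingleton.elim y x, hx, map_zero]
  | succ n ih =>
    have hmeas : MeasurableSet
        {z : ℝ × (Fin n → ℝ) | MvPolynomial.eval (Fin.cons z.1 z.2 : Fin (n + 1) → ℝ) p ≠ 0} := by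
      have hc : Continuous fun z : ℝ × (Fin n → ℝ) => (Fin.cons z.1 z.2 : Fin (n + 1) → ℝ) :=
        Continuous.finCons (A := fun _ => ℝ) continuous_fst continuous_snd
      exact ((MvPolynomial.continuous_eval p).comp hc).measurable
        (measurableSet_singleton (0 : ℝ)).compl
    have hprod : ∀ᵐ z ∂(ν 0).prod (Measure.pi fun j => ν ((0 : Fin (n + 1)).succAbove j)),
        MvPolynomial.eval (Fin.cons z.1 z.2 : Fin (n + 1) → ℝ) p ≠ 0 := by
      rw [Measure.ae_prod_iff_ae_ae hmeas, Measure.ae_ae_comm hmeas]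
      have hq : finSuccEquiv ℝ n p ≠ 0 := by simpa using hp
      obtain ⟨k, hk⟩ : ∃ k, (finSuccEquiv ℝ n p).coeff k ≠ 0 := by
        by_contra! h
        exact hq (Polynomial.ext h)
      filter_upwards [ih (fun j => ν ((0 : Fin (n + 1)).succAbove j)) hk] with y hy
      have hr : (finSuccEquiv ℝ n p).map (MvPolynomial.eval y) ≠ 0 := fun h =>
        hy (by rw [← Polynomial.coeff_map, h, Polynomial.coeff_zero])
      filter_upwards [compl_mem_ae_iff.2
        ((Polynomial.finite_setOfPred_isRoot hr).measure_zero (ν 0))] with x hx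
      rwa [eval_eq_eval_mv_eval']
    filter_upwards [(measurePreserving_piFinSuccAbove ν 0).quasiMeasurePreserving.ae hprod]
      with x hx
    simpa [MeasurableEquiv.piFinSuccAbove, Fin.cons_self_tail] using hx

/-- A nonzero real polynomial in finitely many variables vanishes almost nowhere for any product
of `σ`-finite atomless measures. -/
lemma MvPolynomial.ae_eval_ne_zero {σ : Type*} [Fintype σ] (ν : σ → Measure ℝ)
    [∀ i, SigmaFinite (ν i)] [∀ i, NullSingletonClass (ν i)]
    {p : MvPolynomial σ ℝ} (hp : p ≠ 0) :
    ∀ᵐ x ∂Measure.pi ν, MvPolynomial.eval x p ≠ 0 := by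
  let e := Fintype.equivFin σ
  have hq : rename e p ≠ 0 := by
    simpa using (rename_injective e e.injective).ne hp
  have hmp := (measurePreserving_piCongrLeft ν e.symm).symm
  filter_upwards [hmp.quasiMeasurePreserving.ae
    (ae_eval_ne_zero_fin (fun i => ν (e.symm i)) hq)] with x hx
  rw [eval_rename] at hx
  convert hx using 3
  funext i
  simp [MeasurableEquiv.piCongrLeft, Equiv.piCongrLeft, Equiv.piCongrLeft']

lemma Matrix.mulVec_injective_of_rank_eq {m : Type*} [Fintype m] {n : ℕ}
    {A : Matrix m (Fin n) ℝ} (hA : A.rank = n) : Function.Injective A.mulVec := by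
  have h := A.mulVecLin.finrank_range_add_finrank_ker
  rw [show Module.finrank ℝ (LinearMap.range A.mulVecLin) = n from hA, Module.finrank_fin_fun] at h
  have hker : Module.finrank ℝ (LinearMap.ker A.mulVecLin) = 0 := by omega
  exact LinearMap.ker_eq_bot.mp (Submodule.finrank_eq_zero.mp hker)

/-- If `Φ` has full column rank `D`, `μ` is a positive probability vector, and `H`
is a `d × D` matrix with i.i.d. `N(0, 1/d)` entries, then almost surely the matrix
`Ψᵀ D_μ Ψ` is invertible, where `Ψ = Φ * Hᵀ`. -/
theorem stmt_2 (NN D d : ℕ) (hd : 1 ≤ d) (hdD : d ≤ D)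
    (Φ : Matrix (Fin NN) (Fin D) ℝ) (hΦ : Φ.rank = D)
    (μ : Fin NN → ℝ) (hμpos : ∀ x, 0 < μ x) (hμsum : ∑ x, μ x = 1) :
    ∀ᵐ H ∂(Measure.pi fun _ : Fin d × Fin D =>
        gaussianReal 0 ((1 / (d : ℝ)).toNNReal)),
      IsUnit ((Φ * (Matrix.of fun (i : Fin d) (j : Fin D) => H (i, j))ᵀ)ᵀ *
        Matrix.diagonal μ *
        (Φ * (Matrix.of fun (i : Fin d) (j : Fin D) => H (i, j))ᵀ)) := by
  have hvar : (1 / (d : ℝ)).toNNReal ≠ 0 := by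
    have : (0 : ℝ) < d := by exact_mod_cast hd
    exact (Real.toNNReal_pos.2 (one_div_pos.2 this)).ne'
  have := nullSingletonClass_gaussianReal (μ := 0) hvar
  let Ψ : Matrix (Fin NN) (Fin d) (MvPolynomial (Fin d × Fin D) ℝ) :=
    Φ.map MvPolynomial.C *
      (Matrix.of fun (i : Fin d) (j : Fin D) => MvPolynomial.X (R := ℝ) (i, j))ᵀ
  let p := (Ψᵀ * Matrix.diagonal (fun x => MvPolynomial.C (σ := Fin d × Fin D) (μ x)) * Ψ).det
  have heval (H : Fin d × Fin D → ℝ) : MvPolynomial.eval H p =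
      ((Φ * (Matrix.of fun (i : Fin d) (j : Fin D) => H (i, j))ᵀ)ᵀ * Matrix.diagonal μ *
        (Φ * (Matrix.of fun (i : Fin d) (j : Fin D) => H (i, j))ᵀ)).det := by
    have hΨ : Ψ.map (MvPolynomial.eval H) =
        Φ * (Matrix.of fun (i : Fin d) (j : Fin D) => H (i, j))ᵀ := by
      refine Matrix.map_mul.trans ?_
      congr 1 <;> ext <;> simp
    rw [RingHom.map_det, RingHom.mapMatrix_apply, Matrix.map_mul, Matrix.map_mul,
      Matrix.transpose_map, hΨ, Matrix.diagonal_map (map_zero _)]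
    simp
  have hp : p ≠ 0 := by
    intro h0
    have h := heval fun ij => (1 : Matrix (Fin D) (Fin D) ℝ) (Fin.castLE hdD ij.1) ij.2
    rw [h0, map_zero] at h
    set E : Matrix (Fin d) (Fin D) ℝ := Matrix.of fun i j =>
      (1 : Matrix (Fin D) (Fin D) ℝ) (Fin.castLE hdD i) j with hE
    have hEE : E * Eᵀ = 1 := by
      ext i j
      simp [hE, Matrix.mul_apply, Matrix.one_apply, eq_comm]
    have hinj : Function.Injective (Φ * Eᵀ).mulVec := by
      intro v w hvw
      simp only [← Matrix.mulVec_mulVec] at hvw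
      have := congrArg E.mulVec (Matrix.mulVec_injective_of_rank_eq hΦ hvw)
      simpa [Matrix.mulVec_mulVec, hEE] using this
    have hpd := (Matrix.PosDef.diagonal hμpos).conjTranspose_mul_mul_same hinj
    rw [Matrix.conjTranspose_eq_transpose_of_trivial] at hpd
    exact hpd.det_pos.ne h
  filter_upwards [MvPolynomial.ae_eval_ne_zero
    (fun _ : Fin d × Fin D => gaussianReal 0 ((1 / (d : ℝ)).toNNReal)) hp] with H hH
  rw [Matrix.isUnit_iff_isUnit_det, ← heval]
  exact hH.isUnit
end

section
/- Let P be an N×N row-stochastic matrix, γ ∈ (0,1), λ ∈ [0,1), r ∈ ℝ^N, and define T v = r + γ P v. Then the matrix I − λγP is invertible, and for every v ∈ ℝ^N the series (1−λ) Σ_{i=0}^∞ λ^i T^{i+1} v converges, with sum T^λ v = (I − λγP)⁻¹ r + (1−λ) γ P (I − λγP)⁻¹ v. -/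
open Matrix

theorem norm_mulVec_le_of_rowStochastic {n : Type*} [Fintype n] {P : Matrix n n ℝ}
    (hP0 : ∀ x y, 0 ≤ P x y) (hP1 : ∀ x, ∑ y, P x y = 1) (v : n → ℝ) :
    ‖P *ᵥ v‖ ≤ ‖v‖ := by
  refine (pi_norm_le_iff_of_nonneg (norm_nonneg v)).2 fun x => ?_
  calc ‖∑ y, P x y * v y‖ ≤ ∑ y, ‖P x y * v y‖ := norm_sum_le _ _
    _ ≤ ∑ y, P x y * ‖v‖ := Finset.sum_le_sum fun y _ => by
        rw [norm_mul, Real.norm_of_nonneg (hP0 x y)]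
        exact mul_le_mul_of_nonneg_left (norm_le_pi_norm v y) (hP0 x y)
    _ = ‖v‖ := by rw [← Finset.sum_mul, hP1, one_mul]

theorem isUnit_one_sub_smul_of_rowStochastic {n : Type*} [Fintype n] [DecidableEq n]
    {P : Matrix n n ℝ} (hP0 : ∀ x y, 0 ≤ P x y) (hP1 : ∀ x, ∑ y, P x y = 1) {c : ℝ}
    (hc : |c| < 1) : IsUnit (1 - c • P) := by
  rw [← Matrix.mulVec_injective_iff_isUnit]
  refine (injective_iff_map_eq_zero (1 - c • P).mulVecLin).2 fun x hx => ?_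
  rw [Matrix.mulVecLin_apply, Matrix.sub_mulVec, Matrix.one_mulVec, Matrix.smul_mulVec,
    sub_eq_zero] at hx
  have hle : ‖x‖ ≤ |c| * ‖x‖ := by
    calc ‖x‖ = |c| * ‖P *ᵥ x‖ := by rw [← Real.norm_eq_abs, ← norm_smul, ← hx]
      _ ≤ |c| * ‖x‖ :=
        mul_le_mul_of_nonneg_left (norm_mulVec_le_of_rowStochastic hP0 hP1 x) (abs_nonneg c)
  exact norm_le_zero_iff.1 (by nlinarith [norm_nonneg x])

theorem norm_iterate_bellman_le {n : Type*} [Fintype n] {P : Matrix n n ℝ}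
    (hP0 : ∀ x y, 0 ≤ P x y) (hP1 : ∀ x, ∑ y, P x y = 1) {γ : ℝ} (hγ0 : 0 ≤ γ) (hγ1 : γ < 1)
    {r : n → ℝ} {T : (n → ℝ) → n → ℝ} (hT : ∀ v, T v = r + γ • P *ᵥ v) (v : n → ℝ) (i : ℕ) :
    ‖T^[i] v‖ ≤ ‖v‖ + ‖r‖ / (1 - γ) := by
  have hpos : 0 < 1 - γ := sub_pos.2 hγ1
  induction i with
  | zero => exact le_add_of_nonneg_right (by positivity)
  | succ i ih =>
    rw [Function.iterate_succ_apply', hT]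
    calc ‖r + γ • P *ᵥ T^[i] v‖ ≤ ‖r‖ + γ * ‖P *ᵥ T^[i] v‖ := by
          refine (norm_add_le _ _).trans_eq ?_
          rw [norm_smul, Real.norm_of_nonneg hγ0]
      _ ≤ ‖r‖ + γ * (‖v‖ + ‖r‖ / (1 - γ)) := by
          gcongr
          exact (norm_mulVec_le_of_rowStochastic hP0 hP1 _).trans ih
      _ = γ * ‖v‖ + ‖r‖ / (1 - γ) := by field_simp; ring
      _ ≤ ‖v‖ + ‖r‖ / (1 - γ) := by
          gcongr
          exact mul_le_of_le_one_left (norm_nonneg v) hγ1.le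

/-- For a row-stochastic `P`, `γ ∈ (0,1)`, `λ ∈ [0,1)`, the matrix `I - λγP` is
invertible and the multi-step Bellman series `(1-λ) Σ_i λ^i T^{i+1} v` converges
with sum `(I - λγP)⁻¹ r + (1-λ)γ P (I - λγP)⁻¹ v`, where `T v = r + γ P v`. -/
theorem stmt_5 (NN : ℕ) (hN : 1 ≤ NN)
    (P : Matrix (Fin NN) (Fin NN) ℝ)
    (hP0 : ∀ x y, 0 ≤ P x y) (hP1 : ∀ x, ∑ y, P x y = 1)
    (γ lam : ℝ) (hγ : γ ∈ Set.Ioo (0 : ℝ) 1) (hlam : lam ∈ Set.Ico (0 : ℝ) 1)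
    (r : Fin NN → ℝ)
    (T : (Fin NN → ℝ) → (Fin NN → ℝ)) (hT : ∀ v, T v = r + γ • P.mulVec v) :
    IsUnit ((1 : Matrix (Fin NN) (Fin NN) ℝ) - (lam * γ) • P) ∧
    ∀ v : Fin NN → ℝ,
      HasSum (fun i : ℕ => ((1 - lam) * lam ^ i) • T^[i + 1] v)
        (((1 : Matrix (Fin NN) (Fin NN) ℝ) - (lam * γ) • P)⁻¹.mulVec r +
          ((1 - lam) * γ) •
            P.mulVec
              (((1 : Matrix (Fin NN) (Fin NN) ℝ) - (lam * γ) • P)⁻¹.mulVec v)) := by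
  obtain ⟨hγ0, hγ1⟩ := hγ
  obtain ⟨hl0, hl1⟩ := hlam
  have hU : IsUnit (1 - (lam * γ) • P) := isUnit_one_sub_smul_of_rowStochastic hP0 hP1 <| by
    rw [abs_of_nonneg (by positivity)]
    nlinarith
  refine ⟨hU, fun v => ?_⟩
  have hsum : Summable fun i : ℕ => ((1 - lam) * lam ^ i) • T^[i] v := by
    refine Summable.of_norm_bounded
      (((summable_geometric_of_lt_one hl0 hl1).mul_left (1 - lam)).mul_right
        (‖v‖ + ‖r‖ / (1 - γ))) fun i => ?_
    have hpos : 0 ≤ (1 - lam) * lam ^ i := mul_nonneg (sub_nonneg.2 hl1.le) (pow_nonneg hl0 i)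
    rw [norm_smul, Real.norm_of_nonneg hpos]
    exact mul_le_mul_of_nonneg_left (norm_iterate_bellman_le hP0 hP1 hγ0.le hγ1 hT v i) hpos
  obtain ⟨u, hu⟩ := hsum
  have hconst : HasSum (fun i : ℕ => ((1 - lam) * lam ^ i) • r) r := by
    have h := ((hasSum_geometric_of_lt_one hl0 hl1).mul_left (1 - lam)).smul_const r
    rwa [mul_inv_cancel₀ (sub_pos.2 hl1).ne', one_smul] at h
  have hPu : HasSum (fun i : ℕ => P *ᵥ (((1 - lam) * lam ^ i) • T^[i] v)) (P *ᵥ u) :=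
    hu.map P.mulVecLin P.mulVecLin.continuous_of_finiteDimensional
  have hs : HasSum (fun i : ℕ => ((1 - lam) * lam ^ i) • T^[i + 1] v) (r + γ • P *ᵥ u) := by
    refine (hconst.add (hPu.const_smul γ)).congr_fun fun i => ?_
    rw [Function.iterate_succ_apply', hT, smul_add, Matrix.mulVec_smul, smul_comm γ]
  have hshift : u = (1 - lam) • v + lam • (r + γ • P *ᵥ u) := by
    refine hu.unique ((hasSum_nat_add_iff' 1).1 ?_)
    rw [Finset.sum_range_one, pow_zero, mul_one, Function.iterate_zero_apply, add_sub_cancel_left]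
    refine (hs.const_smul lam).congr_fun fun i => ?_
    rw [smul_smul]
    congr 1
    ring
  convert hs using 1
  have hdet := (Matrix.isUnit_iff_isUnit_det _).1 hU
  have hAu : (1 - (lam * γ) • P) *ᵥ u = (1 - lam) • v + lam • r := by
    rw [Matrix.sub_mulVec, Matrix.one_mulVec, Matrix.smul_mulVec, sub_eq_iff_eq_add, mul_smul,
      add_assoc, ← smul_add]
    exact hshift
  have hu' : u = (1 - (lam * γ) • P)⁻¹ *ᵥ ((1 - lam) • v + lam • r) := by
    rw [← hAu, Matrix.mulVec_mulVec, Matrix.nonsing_inv_mul _ hdet, Matrix.one_mulVec]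
  have hr : (1 - (lam * γ) • P)⁻¹ *ᵥ r =
      r + (lam * γ) • P *ᵥ ((1 - (lam * γ) • P)⁻¹ *ᵥ r) := by
    have h : (1 - (lam * γ) • P) *ᵥ ((1 - (lam * γ) • P)⁻¹ *ᵥ r) = r := by
      rw [Matrix.mulVec_mulVec, Matrix.mul_nonsing_inv _ hdet, Matrix.one_mulVec]
    rwa [Matrix.sub_mulVec, Matrix.one_mulVec, Matrix.smul_mulVec, sub_eq_iff_eq_add] at h
  rw [hu']
  nth_rewrite 1 [hr]
  simp only [Matrix.mulVec_add, Matrix.mulVec_smul]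
  module
end

section
/- The orthogonal projection Π_G is non-expansive with respect to the μ-weighted norm, i.e., ‖Π_G v‖_μ ≤ ‖v‖_μ for all v ∈ ℝ^N, and the composed operator Π_G ∘ T^λ is a contraction with modulus γ(1−λ)/(1−γλ): for all u, v ∈ ℝ^N, ‖Π_G T^λ u − Π_G T^λ v‖_μ ≤ (γ(1−λ)/(1−γλ)) ‖u − v‖_μ, where γ(1−λ)/(1−γλ) < 1. -/
open Matrix

section WeightedNorm

variable {ι κ : Type*} [Fintype ι] [Fintype κ]

theorem sqrt_weighted_sum_eq_norm {μ : ι → ℝ} (hμ : ∀ x, 0 ≤ μ x) (v : ι → ℝ) :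
    Real.sqrt (∑ x, μ x * v x ^ 2) =
      ‖(WithLp.toLp 2 (fun x => Real.sqrt (μ x) * v x) : EuclideanSpace ℝ ι)‖ := by
  rw [EuclideanSpace.norm_eq]
  congr 1
  refine Finset.sum_congr rfl fun x _ => ?_
  rw [Real.norm_eq_abs, sq_abs, mul_pow, Real.sq_sqrt (hμ x)]

theorem sqrt_weighted_sum_add_le {μ : ι → ℝ} (hμ : ∀ x, 0 ≤ μ x) (u v : ι → ℝ) :
    Real.sqrt (∑ x, μ x * (u + v) x ^ 2) ≤
      Real.sqrt (∑ x, μ x * u x ^ 2) + Real.sqrt (∑ x, μ x * v x ^ 2) := by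
  simp only [sqrt_weighted_sum_eq_norm hμ]
  refine le_trans (le_of_eq ?_) (norm_add_le _ _)
  congr 1
  ext x
  simp [mul_add]

theorem sqrt_weighted_sum_smul (μ : ι → ℝ) {c : ℝ} (hc : 0 ≤ c) (v : ι → ℝ) :
    Real.sqrt (∑ x, μ x * (c • v) x ^ 2) = c * Real.sqrt (∑ x, μ x * v x ^ 2) := by
  have h : ∑ x, μ x * (c • v) x ^ 2 = c ^ 2 * ∑ x, μ x * v x ^ 2 := by
    rw [Finset.mul_sum]
    refine Finset.sum_congr rfl fun x _ => ?_
    simp only [Pi.smul_apply, smul_eq_mul]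
    ring
  rw [h, Real.sqrt_mul (sq_nonneg c), Real.sqrt_sq hc]

/-- A stochastic matrix is non-expansive for the norm weighted by a stationary measure. -/
theorem sqrt_weighted_sum_stochastic_mulVec_le {μ : ι → ℝ} (hμ : ∀ x, 0 ≤ μ x)
    {P : Matrix ι ι ℝ} (hP0 : ∀ x y, 0 ≤ P x y) (hP1 : ∀ x, ∑ y, P x y = 1)
    (hstat : ∀ y, ∑ x, μ x * P x y = μ y) (v : ι → ℝ) :
    Real.sqrt (∑ x, μ x * (P *ᵥ v) x ^ 2) ≤ Real.sqrt (∑ x, μ x * v x ^ 2) := by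
  refine Real.sqrt_le_sqrt ?_
  have jensen : ∀ x, (P *ᵥ v) x ^ 2 ≤ ∑ y, P x y * v y ^ 2 := fun x => by
    have h := Finset.sum_sq_le_sum_mul_sum_of_sq_le_mul Finset.univ
      (r := fun y => P x y * v y) (f := fun y => P x y) (g := fun y => P x y * v y ^ 2)
      (fun y _ => hP0 x y) (fun y _ => mul_nonneg (hP0 x y) (sq_nonneg _))
      (fun y _ => le_of_eq (by ring))
    rwa [hP1, one_mul] at h
  calc ∑ x, μ x * (P *ᵥ v) x ^ 2
      ≤ ∑ x, μ x * ∑ y, P x y * v y ^ 2 :=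
        Finset.sum_le_sum fun x _ => mul_le_mul_of_nonneg_left (jensen x) (hμ x)
    _ = ∑ y, (∑ x, μ x * P x y) * v y ^ 2 := by
        simp only [Finset.mul_sum, Finset.sum_mul]
        rw [Finset.sum_comm]
        simp only [mul_assoc]
    _ = ∑ y, μ y * v y ^ 2 := by simp only [hstat]

/-- The resolvent of a stochastic matrix is bounded by `1 / (1 - c)` for the norm weighted by a
stationary measure. -/
theorem sqrt_weighted_sum_resolvent_le [DecidableEq ι] {μ : ι → ℝ} (hμ : ∀ x, 0 ≤ μ x)
    {P : Matrix ι ι ℝ} (hP0 : ∀ x y, 0 ≤ P x y) (hP1 : ∀ x, ∑ y, P x y = 1)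
    (hstat : ∀ y, ∑ x, μ x * P x y = μ y) {c : ℝ} (hc : 0 ≤ c) (v : ι → ℝ) :
    (1 - c) * Real.sqrt (∑ x, μ x * (((1 : Matrix ι ι ℝ) - c • P)⁻¹ *ᵥ v) x ^ 2) ≤
      Real.sqrt (∑ x, μ x * v x ^ 2) := by
  by_cases hA : IsUnit ((1 : Matrix ι ι ℝ) - c • P).det
  · set w := ((1 : Matrix ι ι ℝ) - c • P)⁻¹ *ᵥ v with hw
    have hv : ((1 : Matrix ι ι ℝ) - c • P) *ᵥ w = v := by
      rw [hw, mulVec_mulVec, mul_nonsing_inv _ hA, one_mulVec]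
    have hsum : w = v + c • (P *ᵥ w) := by
      rw [sub_mulVec, one_mulVec, smul_mulVec] at hv
      rw [← hv, sub_add_cancel]
    have h1 := sqrt_weighted_sum_add_le hμ v (c • (P *ᵥ w))
    rw [← hsum, sqrt_weighted_sum_smul μ hc] at h1
    have h2 := mul_le_mul_of_nonneg_left
      (sqrt_weighted_sum_stochastic_mulVec_le hμ hP0 hP1 hstat w) hc
    linarith
  · rw [nonsing_inv_apply_not_isUnit _ hA]
    simp

/-- The weighted projection onto the column space of `Ψ` is non-expansive. -/
theorem sqrt_weighted_sum_projection_le [DecidableEq ι] [DecidableEq κ] {μ : ι → ℝ}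
    (hμ : ∀ x, 0 ≤ μ x) (Ψ : Matrix ι κ ℝ) (v : ι → ℝ) :
    Real.sqrt (∑ x, μ x *
      ((Ψ * (Ψᵀ * diagonal μ * Ψ)⁻¹ * Ψᵀ * diagonal μ) *ᵥ v) x ^ 2) ≤
      Real.sqrt (∑ x, μ x * v x ^ 2) := by
  set G := Ψᵀ * diagonal μ * Ψ with hG
  set B := Ψ * G⁻¹ * Ψᵀ * diagonal μ with hB
  have hGt : Gᵀ = G := by simp [hG, Matrix.mul_assoc]
  have hGinv : G⁻¹ * G * G⁻¹ = G⁻¹ := by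
    by_cases h : IsUnit G.det
    · rw [nonsing_inv_mul _ h, Matrix.one_mul]
    · simp [nonsing_inv_apply_not_isUnit _ h]
  have hBB : Bᵀ * diagonal μ * B = diagonal μ * B := by
    calc Bᵀ * diagonal μ * B
        = diagonal μ * Ψ * (G⁻¹ * G * G⁻¹) * Ψᵀ * diagonal μ := by
          have hBt : Bᵀ = diagonal μ * Ψ * G⁻¹ * Ψᵀ := by
            simp [hB, transpose_nonsing_inv, hGt, Matrix.mul_assoc]
          have hmid : G⁻¹ * G * G⁻¹ = G⁻¹ * (Ψᵀ * diagonal μ * Ψ) * G⁻¹ := rfl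
          rw [hBt, hB, hmid]
          simp only [Matrix.mul_assoc]
      _ = diagonal μ * B := by
          rw [hGinv, hB]
          simp only [Matrix.mul_assoc]
  have hdot : ∀ a b : ι → ℝ, a ⬝ᵥ (diagonal μ *ᵥ b) = ∑ x, μ x * (a x * b x) := fun a b => by
    simp only [dotProduct, mulVec_diagonal]
    exact Finset.sum_congr rfl fun x _ => by ring
  have hinner : ∑ x, μ x * ((B *ᵥ v) x * (B *ᵥ v) x) = ∑ x, μ x * (v x * (B *ᵥ v) x) := by
    have h := congrArg (fun M => v ⬝ᵥ (M *ᵥ v)) hBB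
    simp only [← mulVec_mulVec, dotProduct_mulVec v Bᵀ, vecMul_transpose] at h
    rwa [hdot, hdot] at h
  have hnonneg : 0 ≤ ∑ x, μ x * (v x - (B *ᵥ v) x) ^ 2 :=
    Finset.sum_nonneg fun x _ => mul_nonneg (hμ x) (sq_nonneg _)
  have hexpand : ∑ x, μ x * (v x - (B *ᵥ v) x) ^ 2 =
      ∑ x, μ x * v x ^ 2 - 2 * ∑ x, μ x * (v x * (B *ᵥ v) x) +
        ∑ x, μ x * (B *ᵥ v) x ^ 2 := by
    rw [Finset.mul_sum, ← Finset.sum_sub_distrib, ← Finset.sum_add_distrib]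
    exact Finset.sum_congr rfl fun x _ => by ring
  simp only [← sq] at hinner
  exact Real.sqrt_le_sqrt (by linarith)

end WeightedNorm

/-- The projection `Π_G` is non-expansive for the `μ`-weighted norm, and
`Π_G ∘ T^λ` is a `γ(1-λ)/(1-γλ)`-contraction, with `γ(1-λ)/(1-γλ) < 1`. -/
theorem stmt_6 (NN d : ℕ) (hN : 1 ≤ NN)
    (μ : Fin NN → ℝ) (hμpos : ∀ x, 0 < μ x) (hμsum : ∑ x, μ x = 1)
    (P : Matrix (Fin NN) (Fin NN) ℝ)
    (hP0 : ∀ x y, 0 ≤ P x y) (hP1 : ∀ x, ∑ y, P x y = 1)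
    (hstat : ∀ y, ∑ x, μ x * P x y = μ y)
    (γ lam : ℝ) (hγ : γ ∈ Set.Ioo (0 : ℝ) 1) (hlam : lam ∈ Set.Ico (0 : ℝ) 1)
    (r : Fin NN → ℝ)
    (Ψ : Matrix (Fin NN) (Fin d) ℝ) (hΨ : Ψ.rank = d)
    (Tlam : (Fin NN → ℝ) → (Fin NN → ℝ))
    (hTlam : ∀ v, Tlam v =
      ((1 : Matrix (Fin NN) (Fin NN) ℝ) - (lam * γ) • P)⁻¹.mulVec r +
        ((1 - lam) * γ) •
          P.mulVec (((1 : Matrix (Fin NN) (Fin NN) ℝ) - (lam * γ) • P)⁻¹.mulVec v)) :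
    let PiG := Ψ * (Ψᵀ * Matrix.diagonal μ * Ψ)⁻¹ * Ψᵀ * Matrix.diagonal μ
    (∀ v : Fin NN → ℝ,
       Real.sqrt (∑ x, μ x * (PiG.mulVec v x) ^ 2) ≤
         Real.sqrt (∑ x, μ x * v x ^ 2)) ∧
    (∀ u v : Fin NN → ℝ,
       Real.sqrt (∑ x, μ x * (PiG.mulVec (Tlam u) x - PiG.mulVec (Tlam v) x) ^ 2) ≤
         (γ * (1 - lam) / (1 - γ * lam)) *
           Real.sqrt (∑ x, μ x * (u x - v x) ^ 2)) ∧
    γ * (1 - lam) / (1 - γ * lam) < 1 := by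
  intro PiG
  obtain ⟨hγ0, hγ1⟩ := hγ
  obtain ⟨hl0, hl1⟩ := hlam
  have hμ : ∀ x, 0 ≤ μ x := fun x => (hμpos x).le
  have hden : 0 < 1 - γ * lam := by nlinarith
  have hproj : ∀ v : Fin NN → ℝ, Real.sqrt (∑ x, μ x * (PiG.mulVec v x) ^ 2) ≤
      Real.sqrt (∑ x, μ x * v x ^ 2) := sqrt_weighted_sum_projection_le hμ Ψ
  refine ⟨hproj, fun u v => ?_, by rw [div_lt_one hden]; linarith⟩
  have hk : 0 ≤ (1 - lam) * γ := mul_nonneg (by linarith) hγ0.le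
  set R := ((1 : Matrix (Fin NN) (Fin NN) ℝ) - (lam * γ) • P)⁻¹ with hR
  have hT : Tlam u - Tlam v = ((1 - lam) * γ) • (P *ᵥ (R *ᵥ (u - v))) := by
    rw [hTlam u, hTlam v, mulVec_sub, mulVec_sub, smul_sub]
    abel
  have h1 := hproj (Tlam u - Tlam v)
  rw [hT, sqrt_weighted_sum_smul μ hk, ← hT, mulVec_sub] at h1
  have h2 := sqrt_weighted_sum_stochastic_mulVec_le hμ hP0 hP1 hstat (R *ᵥ (u - v))
  have h3 := sqrt_weighted_sum_resolvent_le hμ hP0 hP1 hstat (mul_nonneg hl0 hγ0.le) (u - v)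
  rw [← hR, mul_comm lam γ, mul_comm, ← le_div_iff₀ hden] at h3
  simp only [Pi.sub_apply] at h1 h3
  refine h1.trans ((mul_le_mul_of_nonneg_left (h2.trans h3) hk).trans (le_of_eq ?_))
  ring
end

section
/- There exists a unique vector V ∈ ℝ^N satisfying the projected multi-step Bellman equation with random projections V = Π_G T^λ V. -/
open Matrix

/-- The squared `μ`-weighted norm of a vector. -/
def weightedSq {ι : Type*} [Fintype ι] (μ v : ι → ℝ) : ℝ := ∑ x, μ x * v x ^ 2

section weightedSq

variable {ι κ : Type*} [Fintype ι] [Fintype κ] {μ : ι → ℝ}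

lemma weightedSq_nonneg (hμ : ∀ x, 0 ≤ μ x) (v : ι → ℝ) : 0 ≤ weightedSq μ v :=
  Finset.sum_nonneg fun x _ => mul_nonneg (hμ x) (sq_nonneg _)

lemma eq_zero_of_weightedSq_nonpos (hμ : ∀ x, 0 < μ x) {v : ι → ℝ}
    (h : weightedSq μ v ≤ 0) : v = 0 := by
  have h0 : weightedSq μ v = 0 := le_antisymm h (weightedSq_nonneg (fun x => (hμ x).le) v)
  funext x
  have hx := (Finset.sum_eq_zero_iff_of_nonneg
    fun x _ => mul_nonneg (hμ x).le (sq_nonneg (v x))).1 h0 x (Finset.mem_univ x)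
  simpa [(hμ x).ne'] using hx

lemma weightedSq_smul (c : ℝ) (v : ι → ℝ) :
    weightedSq μ (c • v) = c ^ 2 * weightedSq μ v := by
  simp only [weightedSq, Finset.mul_sum, Pi.smul_apply, smul_eq_mul]
  exact Finset.sum_congr rfl fun x _ => by ring

/-- A stochastic matrix is nonexpansive in the norm weighted by a stationary distribution. -/
lemma weightedSq_mulVec_le (hμ : ∀ x, 0 ≤ μ x) {P : Matrix ι ι ℝ}
    (hP0 : ∀ x y, 0 ≤ P x y) (hP1 : ∀ x, ∑ y, P x y = 1)
    (hstat : ∀ y, ∑ x, μ x * P x y = μ y) (v : ι → ℝ) :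
    weightedSq μ (P *ᵥ v) ≤ weightedSq μ v := by
  have jensen : ∀ x, (P *ᵥ v) x ^ 2 ≤ ∑ y, P x y * v y ^ 2 := fun x => by
    simpa [Matrix.mulVec, dotProduct] using
      (even_two.convexOn_pow (𝕜 := ℝ)).map_sum_le (t := Finset.univ) (w := P x) (p := v)
        (fun y _ => hP0 x y) (hP1 x) (fun y _ => Set.mem_univ _)
  calc weightedSq μ (P *ᵥ v) ≤ ∑ x, μ x * ∑ y, P x y * v y ^ 2 :=
        Finset.sum_le_sum fun x _ => mul_le_mul_of_nonneg_left (jensen x) (hμ x)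
    _ = ∑ y, (∑ x, μ x * P x y) * v y ^ 2 := by
        simp only [Finset.mul_sum, Finset.sum_mul, ← mul_assoc]
        exact Finset.sum_comm
    _ = weightedSq μ v := by simp only [hstat, weightedSq]

/-- The resolvent `(1 - c P)⁻¹` of a nonexpansive matrix is bounded by `(1 - c)⁻¹`. -/
lemma weightedSq_resolvent_le [DecidableEq ι] (hμ : ∀ x, 0 ≤ μ x) {P : Matrix ι ι ℝ}
    (hP : ∀ v, weightedSq μ (P *ᵥ v) ≤ weightedSq μ v) {c : ℝ} (hc0 : 0 ≤ c) (hc1 : c < 1)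
    (v : ι → ℝ) :
    (1 - c) ^ 2 * weightedSq μ ((1 - c • P)⁻¹ *ᵥ v) ≤ weightedSq μ v := by
  by_cases hA : IsUnit (1 - c • P).det
  · set w := (1 - c • P)⁻¹ *ᵥ v with hw
    have hv : v = w - c • (P *ᵥ w) := by
      have h : (1 - c • P) *ᵥ w = v := by
        rw [hw, Matrix.mulVec_mulVec, Matrix.mul_nonsing_inv _ hA, Matrix.one_mulVec]
      rw [← h, Matrix.sub_mulVec, Matrix.one_mulVec, Matrix.smul_mulVec]
    have convex : (1 - c) * weightedSq μ w ≤
        weightedSq μ v + (1 - c) * c * weightedSq μ (P *ᵥ w) := by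
      simp only [weightedSq, Finset.mul_sum, ← Finset.sum_add_distrib]
      refine Finset.sum_le_sum fun x _ => ?_
      have hx : v x = w x - c * (P *ᵥ w) x := by rw [hv]; rfl
      rw [hx]
      have := mul_nonneg (mul_nonneg (hμ x) hc0) (sq_nonneg (w x - (P *ᵥ w) x))
      linear_combination this
    have := mul_le_mul_of_nonneg_left (hP w) (mul_nonneg (sub_nonneg.2 hc1.le) hc0)
    linear_combination convex + this
  · rw [Matrix.nonsing_inv_apply_not_isUnit _ hA]
    simpa [weightedSq] using weightedSq_nonneg hμ v

/-- The weighted projection onto the column space of `Ψ` is nonexpansive. -/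
lemma weightedSq_projection_le [DecidableEq ι] [DecidableEq κ] (hμ : ∀ x, 0 ≤ μ x)
    (Ψ : Matrix ι κ ℝ) (v : ι → ℝ) :
    weightedSq μ ((Ψ * (Ψᵀ * diagonal μ * Ψ)⁻¹ * Ψᵀ * diagonal μ) *ᵥ v) ≤ weightedSq μ v := by
  by_cases hG : IsUnit (Ψᵀ * diagonal μ * Ψ).det
  · set z := (Ψᵀ * diagonal μ * Ψ)⁻¹ *ᵥ ((Ψᵀ * diagonal μ) *ᵥ v) with hz
    have hu : (Ψ * (Ψᵀ * diagonal μ * Ψ)⁻¹ * Ψᵀ * diagonal μ) *ᵥ v = Ψ *ᵥ z := by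
      simp only [hz, Matrix.mulVec_mulVec, Matrix.mul_assoc]
    have normal : (Ψᵀ * diagonal μ) *ᵥ (Ψ *ᵥ z) = (Ψᵀ * diagonal μ) *ᵥ v := by
      rw [Matrix.mulVec_mulVec, hz, Matrix.mulVec_mulVec, Matrix.mul_nonsing_inv _ hG,
        Matrix.one_mulVec]
    have pairing : ∀ u, z ⬝ᵥ ((Ψᵀ * diagonal μ) *ᵥ u) = ∑ x, μ x * ((Ψ *ᵥ z) x * u x) := by
      intro u
      rw [← Matrix.mulVec_mulVec, Matrix.dotProduct_mulVec, Matrix.vecMul_transpose]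
      simp only [dotProduct, Matrix.mulVec_diagonal]
      exact Finset.sum_congr rfl fun x _ => by ring
    have orth := congrArg (z ⬝ᵥ ·) normal
    simp only [pairing] at orth
    have expand : weightedSq μ (v - Ψ *ᵥ z) = weightedSq μ v
        - 2 * ∑ x, μ x * ((Ψ *ᵥ z) x * v x) + ∑ x, μ x * ((Ψ *ᵥ z) x * (Ψ *ᵥ z) x) := by
      simp only [weightedSq, Finset.mul_sum, ← Finset.sum_add_distrib, ← Finset.sum_sub_distrib]
      exact Finset.sum_congr rfl fun x _ => by rw [Pi.sub_apply]; ring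
    have hsq : weightedSq μ (Ψ *ᵥ z) = ∑ x, μ x * ((Ψ *ᵥ z) x * (Ψ *ᵥ z) x) :=
      Finset.sum_congr rfl fun x _ => by ring
    rw [hu]
    linarith [weightedSq_nonneg hμ (v - Ψ *ᵥ z)]
  · rw [Matrix.nonsing_inv_apply_not_isUnit _ hG]
    simpa [weightedSq] using weightedSq_nonneg hμ v

end weightedSq

/-- An affine fixed-point equation has a unique solution when the linear part has no nonzero
fixed vector. -/
lemma existsUnique_eq_add_mulVec {ι : Type*} [Fintype ι] [DecidableEq ι] (b : ι → ℝ)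
    (K : Matrix ι ι ℝ) (hK : ∀ v, v = K *ᵥ v → v = 0) : ∃! v, v = b + K *ᵥ v := by
  have inj : Function.Injective (1 - K).mulVecLin := by
    rw [← LinearMap.ker_eq_bot, LinearMap.ker_eq_bot']
    intro v hv
    rw [Matrix.mulVecLin_apply, Matrix.sub_mulVec, Matrix.one_mulVec, sub_eq_zero] at hv
    exact hK v hv
  have iff_eq : ∀ v, v = b + K *ᵥ v ↔ (1 - K).mulVecLin v = b := fun v => by
    rw [Matrix.mulVecLin_apply, Matrix.sub_mulVec, Matrix.one_mulVec, sub_eq_iff_eq_add]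
  simp only [iff_eq]
  exact (show Function.Bijective _ from
    ⟨inj, LinearMap.injective_iff_surjective.1 inj⟩).existsUnique b

/-- There is a unique `V` satisfying the projected multi-step Bellman equation
with random projections `V = Π_G T^λ V`. -/
theorem stmt_7 (NN d : ℕ) (hN : 1 ≤ NN)
    (μ : Fin NN → ℝ) (hμpos : ∀ x, 0 < μ x) (hμsum : ∑ x, μ x = 1)
    (P : Matrix (Fin NN) (Fin NN) ℝ)
    (hP0 : ∀ x y, 0 ≤ P x y) (hP1 : ∀ x, ∑ y, P x y = 1)
    (hstat : ∀ y, ∑ x, μ x * P x y = μ y)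
    (γ lam : ℝ) (hγ : γ ∈ Set.Ioo (0 : ℝ) 1) (hlam : lam ∈ Set.Ico (0 : ℝ) 1)
    (r : Fin NN → ℝ)
    (Ψ : Matrix (Fin NN) (Fin d) ℝ) (hΨ : Ψ.rank = d)
    (Tlam : (Fin NN → ℝ) → (Fin NN → ℝ))
    (hTlam : ∀ v, Tlam v =
      ((1 : Matrix (Fin NN) (Fin NN) ℝ) - (lam * γ) • P)⁻¹.mulVec r +
        ((1 - lam) * γ) •
          P.mulVec (((1 : Matrix (Fin NN) (Fin NN) ℝ) - (lam * γ) • P)⁻¹.mulVec v)) :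
    let PiG := Ψ * (Ψᵀ * Matrix.diagonal μ * Ψ)⁻¹ * Ψᵀ * Matrix.diagonal μ
    ∃! V : Fin NN → ℝ, V = PiG.mulVec (Tlam V) := by
  intro PiG
  obtain ⟨hγ0, hγ1⟩ := hγ
  obtain ⟨hl0, hl1⟩ := hlam
  have hμ : ∀ x, 0 ≤ μ x := fun x => (hμpos x).le
  have hPi : ∀ v, weightedSq μ (PiG *ᵥ v) ≤ weightedSq μ v := weightedSq_projection_le hμ Ψ
  clear_value PiG
  have hP := weightedSq_mulVec_le hμ hP0 hP1 hstat
  have hc0 : 0 ≤ lam * γ := mul_nonneg hl0 hγ0.le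
  have hc1 : lam * γ < 1 := mul_lt_one_of_nonneg_of_lt_one_left hl0 hl1 hγ1.le
  set R := ((1 : Matrix (Fin NN) (Fin NN) ℝ) - (lam * γ) • P)⁻¹
  have affine : ∀ V, PiG *ᵥ Tlam V =
      PiG *ᵥ (R *ᵥ r) + (PiG * (((1 - lam) * γ) • (P * R))) *ᵥ V := fun V => by
    rw [hTlam, Matrix.mulVec_add, ← Matrix.mulVec_mulVec, Matrix.smul_mulVec,
      ← Matrix.mulVec_mulVec]
  simp only [affine]
  refine existsUnique_eq_add_mulVec _ _ fun v hv => eq_zero_of_weightedSq_nonpos hμpos ?_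
  rw [← Matrix.mulVec_mulVec, Matrix.smul_mulVec, ← Matrix.mulVec_mulVec] at hv
  have hproj := hPi (((1 - lam) * γ) • (P *ᵥ (R *ᵥ v)))
  rw [← hv, weightedSq_smul] at hproj
  have hres := weightedSq_resolvent_le hμ hP hc0 hc1 v
  have hbound : weightedSq μ v ≤ ((1 - lam) * γ) ^ 2 * weightedSq μ (R *ᵥ v) :=
    hproj.trans (mul_le_mul_of_nonneg_left (hP _) (sq_nonneg _))
  have hlt : ((1 - lam) * γ) ^ 2 < (1 - lam * γ) ^ 2 :=
    pow_lt_pow_left₀ (by linarith) (mul_nonneg (by linarith) hγ0.le) two_ne_zero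
  have hRv : weightedSq μ (R *ᵥ v) ≤ 0 := by
    by_contra! h
    exact absurd (hres.trans hbound) (not_le.2 (mul_lt_mul_of_pos_right hlt h))
  exact hbound.trans (mul_nonpos_of_nonneg_of_nonpos (sq_nonneg _) hRv)
end

section
/- Define the matrix M := (1−λ) γ P (I − λγP)⁻¹. Then for every v ∈ ℝ^N, ‖M v‖_μ ≤ (γ(1−λ)/(1−λγ)) ‖v‖_μ; in particular the μ-weighted operator norm of M is at most γ(1−λ)/(1−λγ) < 1. -/
open Matrix

/-- A Markov operator is nonexpansive in the `L²` norm of a stationary distribution. -/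
theorem sum_mul_mulVec_sq_le {ι : Type*} [Fintype ι] {μ : ι → ℝ} {P : Matrix ι ι ℝ}
    (hμ : ∀ x, 0 ≤ μ x) (hP0 : ∀ x y, 0 ≤ P x y) (hP1 : ∀ x, ∑ y, P x y = 1)
    (hstat : ∀ y, ∑ x, μ x * P x y = μ y) (w : ι → ℝ) :
    ∑ x, μ x * (P *ᵥ w) x ^ 2 ≤ ∑ x, μ x * w x ^ 2 := by
  have jensen (x : ι) : (P *ᵥ w) x ^ 2 ≤ ∑ y, P x y * w y ^ 2 := by
    simpa [mulVec, dotProduct] using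
      (even_two.convexOn_pow (𝕜 := ℝ)).map_sum_le (t := Finset.univ) (w := P x) (p := w)
        (fun y _ => hP0 x y) (hP1 x) (fun _ _ => Set.mem_univ _)
  calc ∑ x, μ x * (P *ᵥ w) x ^ 2
      ≤ ∑ x, μ x * ∑ y, P x y * w y ^ 2 :=
        Finset.sum_le_sum fun x _ => mul_le_mul_of_nonneg_left (jensen x) (hμ x)
    _ = ∑ y, (∑ x, μ x * P x y) * w y ^ 2 := by
        simp only [Finset.mul_sum, Finset.sum_mul, mul_assoc]
        exact Finset.sum_comm
    _ = ∑ y, μ y * w y ^ 2 := by simp only [hstat]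

/-- Resolvent bound `‖w‖_μ ≤ ‖w - c P w‖_μ / (1 - c)`, in squared form. -/
theorem sum_mul_sq_le_resolvent {ι : Type*} [Fintype ι] {μ : ι → ℝ} {P : Matrix ι ι ℝ}
    (hμ : ∀ x, 0 ≤ μ x) (hP0 : ∀ x y, 0 ≤ P x y) (hP1 : ∀ x, ∑ y, P x y = 1)
    (hstat : ∀ y, ∑ x, μ x * P x y = μ y) {c : ℝ} (hc0 : 0 ≤ c) (hc1 : c < 1) (w : ι → ℝ) :
    (1 - c) ^ 2 * ∑ x, μ x * w x ^ 2 ≤ ∑ x, μ x * (w x - c * (P *ᵥ w) x) ^ 2 := by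
  have pointwise : (1 - c) * ∑ x, μ x * w x ^ 2 ≤
      ∑ x, μ x * (w x - c * (P *ᵥ w) x) ^ 2 + (1 - c) * c * ∑ x, μ x * (P *ᵥ w) x ^ 2 := by
    rw [Finset.mul_sum, Finset.mul_sum, ← Finset.sum_add_distrib]
    refine Finset.sum_le_sum fun x _ => ?_
    linear_combination mul_nonneg (hμ x) (mul_nonneg hc0 (sq_nonneg (w x - (P *ᵥ w) x)))
  have contraction := mul_le_mul_of_nonneg_left
    (sum_mul_mulVec_sq_le hμ hP0 hP1 hstat w) (mul_nonneg (sub_nonneg.2 hc1.le) hc0)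
  linear_combination pointwise + contraction

/-- For `M = (1-λ)γ P (I - λγP)⁻¹`, one has `‖M v‖_μ ≤ (γ(1-λ)/(1-λγ)) ‖v‖_μ`
for every `v`, with `γ(1-λ)/(1-λγ) < 1`. -/
theorem stmt_8 (NN : ℕ) (hN : 1 ≤ NN)
    (μ : Fin NN → ℝ) (hμpos : ∀ x, 0 < μ x) (hμsum : ∑ x, μ x = 1)
    (P : Matrix (Fin NN) (Fin NN) ℝ)
    (hP0 : ∀ x y, 0 ≤ P x y) (hP1 : ∀ x, ∑ y, P x y = 1)
    (hstat : ∀ y, ∑ x, μ x * P x y = μ y)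
    (γ lam : ℝ) (hγ : γ ∈ Set.Ioo (0 : ℝ) 1) (hlam : lam ∈ Set.Ico (0 : ℝ) 1) :
    let M := ((1 - lam) * γ) •
      (P * ((1 : Matrix (Fin NN) (Fin NN) ℝ) - (lam * γ) • P)⁻¹)
    (∀ v : Fin NN → ℝ,
       Real.sqrt (∑ x, μ x * (M.mulVec v x) ^ 2) ≤
         (γ * (1 - lam) / (1 - lam * γ)) * Real.sqrt (∑ x, μ x * v x ^ 2)) ∧
    γ * (1 - lam) / (1 - lam * γ) < 1 := by
  obtain ⟨hγ0, hγ1⟩ := hγ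
  obtain ⟨hl0, hl1⟩ := hlam
  have hμ x := (hμpos x).le
  have hc0 : 0 ≤ lam * γ := by positivity
  have hc1 : lam * γ < 1 := by nlinarith
  have hd : 0 < 1 - lam * γ := sub_pos.2 hc1
  have hk : 0 ≤ γ * (1 - lam) := mul_nonneg hγ0.le (sub_nonneg.2 hl1.le)
  intro M
  refine ⟨fun v => ?_, by rw [div_lt_one hd]; linarith⟩
  have hV : 0 ≤ ∑ x, μ x * v x ^ 2 := Finset.sum_nonneg fun x _ => mul_nonneg (hμ x) (sq_nonneg _)
  refine Real.sqrt_le_iff.2 ⟨by positivity, ?_⟩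
  rw [mul_pow, Real.sq_sqrt hV]
  set A := (1 : Matrix (Fin NN) (Fin NN) ℝ) - (lam * γ) • P with hA
  set w := A⁻¹ *ᵥ v with hw
  have hM x : (M *ᵥ v) x = γ * (1 - lam) * (P *ᵥ w) x := by
    simp only [M, smul_mulVec, ← mulVec_mulVec, Pi.smul_apply, smul_eq_mul, w, A]
    ring
  have hwv : (1 - lam * γ) ^ 2 * ∑ x, μ x * w x ^ 2 ≤ ∑ x, μ x * v x ^ 2 := by
    by_cases hdet : IsUnit A.det
    · have hAw : A *ᵥ w = v := by rw [hw, mulVec_mulVec, mul_nonsing_inv A hdet, one_mulVec]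
      have hv x : v x = w x - lam * γ * (P *ᵥ w) x := by
        rw [← congrFun hAw x]
        simp [hA, sub_mulVec, smul_mulVec]
      simpa only [hv] using sum_mul_sq_le_resolvent hμ hP0 hP1 hstat hc0 hc1 w
    · have hw0 : w = 0 := by rw [hw, nonsing_inv_apply_not_isUnit A hdet, zero_mulVec]
      simpa [hw0] using hV
  calc ∑ x, μ x * (M *ᵥ v) x ^ 2
      = (γ * (1 - lam)) ^ 2 * ∑ x, μ x * (P *ᵥ w) x ^ 2 := by
        rw [Finset.mul_sum]
        exact Finset.sum_congr rfl fun x _ => by rw [hM]; ring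
    _ ≤ (γ * (1 - lam)) ^ 2 * ∑ x, μ x * w x ^ 2 :=
        mul_le_mul_of_nonneg_left (sum_mul_mulVec_sq_le hμ hP0 hP1 hstat w) (sq_nonneg _)
    _ = (γ * (1 - lam) / (1 - lam * γ)) ^ 2 *
          ((1 - lam * γ) ^ 2 * ∑ x, μ x * w x ^ 2) := by
        rw [div_pow, ← mul_assoc, div_mul_cancel₀ _ (pow_pos hd 2).ne']
    _ ≤ (γ * (1 - lam) / (1 - lam * γ)) ^ 2 * ∑ x, μ x * v x ^ 2 :=
        mul_le_mul_of_nonneg_left hwv (sq_nonneg _)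
end

section
/- The d×d matrix A := Ψᵀ D_μ (I − γP) (I − λγP)⁻¹ Ψ is invertible. -/
open Matrix

/-- The weighted form `⟨(I - aP) w, (I - bP) w⟩_μ` is positive definite for `a, b ∈ [0, 1)`. -/
theorem sum_mul_sub_mulVec_pos {ι : Type*} [Fintype ι] {μ : ι → ℝ} {P : Matrix ι ι ℝ}
    (hμ : ∀ x, 0 < μ x) (hP0 : ∀ x y, 0 ≤ P x y) (hP1 : ∀ x, ∑ y, P x y = 1)
    (hstat : ∀ y, ∑ x, μ x * P x y = μ y) {a b : ℝ} (ha0 : 0 ≤ a) (ha1 : a < 1)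
    (hb0 : 0 ≤ b) (hb1 : b < 1) {w : ι → ℝ} (hw : w ≠ 0) :
    0 < ∑ x, μ x * ((w x - a * (P *ᵥ w) x) * (w x - b * (P *ᵥ w) x)) := by
  have hTS := sum_mul_mulVec_sq_le (fun x => (hμ x).le) hP0 hP1 hstat w
  set q := P *ᵥ w
  set S := ∑ x, μ x * w x ^ 2 with hS
  set T := ∑ x, μ x * q x ^ 2 with hT
  have hT0 : 0 ≤ T := Finset.sum_nonneg fun x _ => mul_nonneg (hμ x).le (sq_nonneg _)
  have hS0 : 0 < S := by
    obtain ⟨x, hx⟩ := Function.ne_iff.mp hw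
    exact Finset.sum_pos' (fun y _ => mul_nonneg (hμ y).le (sq_nonneg _))
      ⟨x, Finset.mem_univ x, mul_pos (hμ x) (sq_pos_of_ne_zero hx)⟩
  have hlower : (1 - (a + b) / 2) * S + (a * b - (a + b) / 2) * T ≤
      ∑ x, μ x * ((w x - a * q x) * (w x - b * q x)) := by
    rw [hS, hT, Finset.mul_sum, Finset.mul_sum, ← Finset.sum_add_distrib]
    refine Finset.sum_le_sum fun x _ => ?_
    have h : 0 ≤ μ x * ((a + b) / 2 * (w x - q x) ^ 2) :=
      mul_nonneg (hμ x).le (mul_nonneg (by linarith) (sq_nonneg _))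
    linarith
  refine lt_of_lt_of_le ?_ hlower
  have h1 : 0 < (1 - a) * (1 - b) * S :=
    mul_pos (mul_pos (by linarith) (by linarith)) hS0
  have h2 : 0 ≤ ((a + b) / 2 - a * b) * (S - T) :=
    mul_nonneg (by nlinarith) (by linarith)
  linarith

/-- The `d × d` matrix `A = Ψᵀ D_μ (I - γP)(I - λγP)⁻¹ Ψ` is invertible. -/
theorem stmt_9 (NN d : ℕ) (hN : 1 ≤ NN)
    (μ : Fin NN → ℝ) (hμpos : ∀ x, 0 < μ x) (hμsum : ∑ x, μ x = 1)
    (P : Matrix (Fin NN) (Fin NN) ℝ)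
    (hP0 : ∀ x y, 0 ≤ P x y) (hP1 : ∀ x, ∑ y, P x y = 1)
    (hstat : ∀ y, ∑ x, μ x * P x y = μ y)
    (γ lam : ℝ) (hγ : γ ∈ Set.Ioo (0 : ℝ) 1) (hlam : lam ∈ Set.Ico (0 : ℝ) 1)
    (Ψ : Matrix (Fin NN) (Fin d) ℝ) (hΨ : Ψ.rank = d) :
    IsUnit (Ψᵀ * Matrix.diagonal μ *
      (((1 : Matrix (Fin NN) (Fin NN) ℝ) - γ • P) *
        ((1 : Matrix (Fin NN) (Fin NN) ℝ) - (lam * γ) • P)⁻¹) * Ψ) := by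
  obtain ⟨hγ0, hγ1⟩ := hγ
  obtain ⟨hl0, hl1⟩ := hlam
  have ha0 : 0 ≤ lam * γ := mul_nonneg hl0 hγ0.le
  have ha1 : lam * γ < 1 := by nlinarith
  have hsub (c : ℝ) (w : Fin NN → ℝ) (x : Fin NN) :
      (((1 : Matrix (Fin NN) (Fin NN) ℝ) - c • P) *ᵥ w) x = w x - c * (P *ᵥ w) x := by
    simp [sub_mulVec, smul_mulVec]
  have hpos {w : Fin NN → ℝ} (hw : w ≠ 0) :=
    sum_mul_sub_mulVec_pos hμpos hP0 hP1 hstat ha0 ha1 hγ0.le hγ1 hw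
  have hunit : IsUnit ((1 : Matrix (Fin NN) (Fin NN) ℝ) - (lam * γ) • P) := by
    rw [← mulVec_injective_iff_isUnit, ← coe_mulVecLin, injective_iff_map_eq_zero]
    intro w hw
    rw [mulVecLin_apply] at hw
    by_contra hne
    refine (hpos hne).ne' (Finset.sum_eq_zero fun x _ => ?_)
    rw [← hsub, hw]
    simp
  have hΨinj : Function.Injective Ψ.mulVec := by
    rw [mulVec_injective_iff, linearIndependent_iff_card_eq_finrank_span,
      Fintype.card_fin]
    exact hΨ.symm.trans Ψ.rank_eq_finrank_span_cols
  rw [← mulVec_injective_iff_isUnit, ← coe_mulVecLin, injective_iff_map_eq_zero]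
  intro c hc
  rw [mulVecLin_apply] at hc
  set M := (1 : Matrix (Fin NN) (Fin NN) ℝ) - (lam * γ) • P
  set w := M⁻¹ *ᵥ (Ψ *ᵥ c) with hw
  have hMw : M *ᵥ w = Ψ *ᵥ c := by
    rw [hw, mulVec_mulVec, mul_nonsing_inv _ ((isUnit_iff_isUnit_det M).mp hunit), one_mulVec]
  have hform : ∑ x, μ x * ((w x - lam * γ * (P *ᵥ w) x) * (w x - γ * (P *ᵥ w) x)) = 0 := by
    have h0 : c ⬝ᵥ (Ψᵀ *ᵥ (diagonal μ *ᵥ ((1 - γ • P) *ᵥ w))) = 0 := by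
      rw [hw]
      simp only [mulVec_mulVec, ← Matrix.mul_assoc] at hc ⊢
      rw [hc, dotProduct_zero]
    rw [dotProduct_mulVec, vecMul_transpose, ← hMw] at h0
    rw [← h0, dotProduct]
    refine Finset.sum_congr rfl fun x _ => ?_
    rw [mulVec_diagonal, hsub, hsub]
    ring
  have hw0 : w = 0 := by
    by_contra hne
    exact (hpos hne).ne' hform
  apply hΨinj
  rw [← hMw, hw0, mulVec_zero, mulVec_zero]
end

section
/- Define M := (1−λ) γ P (I − λγP)⁻¹. Then the N×N matrix I − Π_G M is invertible and for every v ∈ ℝ^N, ‖(I − Π_G M)⁻¹ v‖_μ ≤ ((1−λγ)/(1−γ)) ‖v‖_μ. -/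
open Matrix

/-- The norm `‖v‖_μ = (∑ x, μ x * v x ^ 2) ^ (1 / 2)`. -/
noncomputable def weightedNorm {ι : Type*} [Fintype ι] (μ v : ι → ℝ) : ℝ :=
  Real.sqrt (∑ x, μ x * v x ^ 2)

section WeightedNorm

variable {ι : Type*} [Fintype ι] {μ : ι → ℝ}

lemma weightedNorm_eq_norm (hμ : ∀ x, 0 ≤ μ x) (v : ι → ℝ) :
    weightedNorm μ v = ‖WithLp.toLp 2 (fun x => Real.sqrt (μ x) * v x)‖ := by
  rw [EuclideanSpace.norm_eq, weightedNorm]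
  congr 1
  refine Finset.sum_congr rfl fun x _ => ?_
  simp only [Real.norm_eq_abs, sq_abs, mul_pow, Real.sq_sqrt (hμ x)]

lemma weightedNorm_nonneg (v : ι → ℝ) : 0 ≤ weightedNorm μ v := Real.sqrt_nonneg _

lemma weightedNorm_add_le (hμ : ∀ x, 0 ≤ μ x) (u v : ι → ℝ) :
    weightedNorm μ (u + v) ≤ weightedNorm μ u + weightedNorm μ v := by
  simp only [weightedNorm_eq_norm hμ]
  refine le_trans (le_of_eq ?_) (norm_add_le _ _)
  congr 1
  ext x
  simp [mul_add]

lemma weightedNorm_smul (hμ : ∀ x, 0 ≤ μ x) {c : ℝ} (hc : 0 ≤ c) (v : ι → ℝ) :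
    weightedNorm μ (c • v) = c * weightedNorm μ v := by
  simp only [weightedNorm_eq_norm hμ]
  rw [← Real.norm_of_nonneg hc, ← norm_smul, Real.norm_of_nonneg hc]
  congr 1
  ext x
  simp [mul_left_comm]

lemma eq_zero_of_weightedNorm_le_zero (hμ : ∀ x, 0 < μ x) {v : ι → ℝ}
    (h : weightedNorm μ v ≤ 0) : v = 0 := by
  have hnn : ∀ x ∈ Finset.univ, 0 ≤ μ x * v x ^ 2 := fun x _ => by
    have := hμ x
    positivity
  have h0 := (Finset.sum_eq_zero_iff_of_nonneg hnn).1
    (le_antisymm (Real.sqrt_eq_zero'.1 (le_antisymm h (Real.sqrt_nonneg _)))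
      (Finset.sum_nonneg hnn))
  ext x
  simpa [(hμ x).ne'] using h0 x (Finset.mem_univ x)

lemma weightedNorm_stochastic_mulVec_le (hμ : ∀ x, 0 ≤ μ x) {P : Matrix ι ι ℝ}
    (hP0 : ∀ x y, 0 ≤ P x y) (hP1 : ∀ x, ∑ y, P x y = 1)
    (hstat : ∀ y, ∑ x, μ x * P x y = μ y) (v : ι → ℝ) :
    weightedNorm μ (P *ᵥ v) ≤ weightedNorm μ v := by
  refine Real.sqrt_le_sqrt ?_
  calc ∑ x, μ x * (P *ᵥ v) x ^ 2
      ≤ ∑ x, μ x * ∑ y, P x y * v y ^ 2 := by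
        refine Finset.sum_le_sum fun x _ => mul_le_mul_of_nonneg_left ?_ (hμ x)
        exact Real.pow_arith_mean_le_arith_mean_pow_of_even _ _ _ (fun y _ => hP0 x y) (hP1 x)
          even_two
    _ = ∑ y, (∑ x, μ x * P x y) * v y ^ 2 := by
        simp only [Finset.mul_sum, Finset.sum_mul, mul_assoc]
        exact Finset.sum_comm
    _ = ∑ y, μ y * v y ^ 2 := by simp only [hstat]

variable [DecidableEq ι]

/-- A `μ`-self-adjoint idempotent does not increase the `μ`-norm. -/
lemma weightedNorm_projection_mulVec_le (hμ : ∀ x, 0 ≤ μ x) {Q : Matrix ι ι ℝ}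
    (hQ : Qᵀ * diagonal μ * Q = diagonal μ * Q) (v : ι → ℝ) :
    weightedNorm μ (Q *ᵥ v) ≤ weightedNorm μ v := by
  have hself : ∑ x, μ x * (Q *ᵥ v) x ^ 2 = ∑ x, μ x * (v x * (Q *ᵥ v) x) := by
    have h : (Q *ᵥ v) ⬝ᵥ (diagonal μ *ᵥ (Q *ᵥ v)) = v ⬝ᵥ (diagonal μ *ᵥ (Q *ᵥ v)) := by
      rw [← vecMul_transpose, ← dotProduct_mulVec, vecMul_transpose]
      simp only [mulVec_mulVec, ← Matrix.mul_assoc, hQ]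
    simp only [dotProduct, mulVec_diagonal] at h
    convert h using 2 <;> ring
  have hdiff : 0 ≤ ∑ x, μ x * (v x - (Q *ᵥ v) x) ^ 2 :=
    Finset.sum_nonneg fun x _ => mul_nonneg (hμ x) (sq_nonneg _)
  have hexpand : ∑ x, μ x * (v x - (Q *ᵥ v) x) ^ 2 =
      ∑ x, μ x * v x ^ 2 - 2 * ∑ x, μ x * (v x * (Q *ᵥ v) x) + ∑ x, μ x * (Q *ᵥ v) x ^ 2 := by
    rw [Finset.mul_sum, ← Finset.sum_sub_distrib, ← Finset.sum_add_distrib]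
    exact Finset.sum_congr rfl fun x _ => by ring
  exact Real.sqrt_le_sqrt (by linarith)

/-- The matrix `Ψ (Ψᵀ D Ψ)⁻¹ Ψᵀ D` is a `D`-self-adjoint idempotent; the identity also holds
when the Gram matrix is singular. -/
lemma gramProjection_transpose_mul {κ : Type*} [Fintype κ] [DecidableEq κ]
    (μ : ι → ℝ) (Ψ : Matrix ι κ ℝ) :
    (Ψ * (Ψᵀ * diagonal μ * Ψ)⁻¹ * Ψᵀ * diagonal μ)ᵀ * diagonal μ *
        (Ψ * (Ψᵀ * diagonal μ * Ψ)⁻¹ * Ψᵀ * diagonal μ) =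
      diagonal μ * (Ψ * (Ψᵀ * diagonal μ * Ψ)⁻¹ * Ψᵀ * diagonal μ) := by
  have hsymm : (Ψᵀ * diagonal μ * Ψ)ᵀ = Ψᵀ * diagonal μ * Ψ := by
    simp [transpose_mul, Matrix.mul_assoc]
  have hinv : (Ψᵀ * diagonal μ * Ψ)⁻¹ * (Ψᵀ * diagonal μ * Ψ) * (Ψᵀ * diagonal μ * Ψ)⁻¹ =
      (Ψᵀ * diagonal μ * Ψ)⁻¹ := by
    by_cases h : IsUnit (Ψᵀ * diagonal μ * Ψ).det
    · rw [nonsing_inv_mul _ h, Matrix.one_mul]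
    · simp [nonsing_inv_apply_not_isUnit _ h]
  calc _ = diagonal μ * Ψ * ((Ψᵀ * diagonal μ * Ψ)⁻¹ * (Ψᵀ * diagonal μ * Ψ) *
          (Ψᵀ * diagonal μ * Ψ)⁻¹) * Ψᵀ * diagonal μ := by
        rw [transpose_mul, transpose_mul, transpose_mul, transpose_nonsing_inv, hsymm,
          transpose_transpose, diagonal_transpose]
        simp only [Matrix.mul_assoc]
    _ = _ := by
        rw [hinv]
        simp only [Matrix.mul_assoc]

/-- Neumann-type bound for a contraction in the `μ`-norm. -/
lemma isUnit_one_sub_and_weightedNorm_inv_mulVec_le (hμ : ∀ x, 0 < μ x) {A : Matrix ι ι ℝ}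
    {c : ℝ} (hc : c < 1) (hA : ∀ v, weightedNorm μ (A *ᵥ v) ≤ c * weightedNorm μ v) :
    IsUnit (1 - A) ∧
      ∀ v, weightedNorm μ ((1 - A)⁻¹ *ᵥ v) ≤ (1 - c)⁻¹ * weightedNorm μ v := by
  have hc' : 0 < 1 - c := sub_pos.2 hc
  have hlower : ∀ w, (1 - c) * weightedNorm μ w ≤ weightedNorm μ ((1 - A) *ᵥ w) := fun w => by
    have h := weightedNorm_add_le (fun x => (hμ x).le) ((1 - A) *ᵥ w) (A *ᵥ w)
    rw [← add_mulVec, sub_add_cancel, one_mulVec] at h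
    linarith [hA w]
  have hunit : IsUnit (1 - A) := by
    rw [← mulVec_injective_iff_isUnit, ← coe_mulVecLin, injective_iff_map_eq_zero]
    intro w hw
    rw [mulVecLin_apply] at hw
    have h := hlower w
    rw [hw] at h
    have h0 : weightedNorm μ (0 : ι → ℝ) = 0 := by simp [weightedNorm]
    rw [h0] at h
    exact eq_zero_of_weightedNorm_le_zero hμ (nonpos_of_mul_nonpos_right h hc')
  refine ⟨hunit, fun v => ?_⟩
  have h := hlower ((1 - A)⁻¹ *ᵥ v)
  rw [mulVec_mulVec, mul_nonsing_inv _ ((isUnit_iff_isUnit_det _).1 hunit), one_mulVec] at h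
  rwa [le_inv_mul_iff₀ hc']

end WeightedNorm



/-- `I - Π_G M` is invertible and `‖(I - Π_G M)⁻¹ v‖_μ ≤ ((1-λγ)/(1-γ)) ‖v‖_μ`,
where `M = (1-λ)γ P (I - λγP)⁻¹`. -/
theorem stmt_12 (NN d : ℕ) (hN : 1 ≤ NN)
    (μ : Fin NN → ℝ) (hμpos : ∀ x, 0 < μ x) (hμsum : ∑ x, μ x = 1)
    (P : Matrix (Fin NN) (Fin NN) ℝ)
    (hP0 : ∀ x y, 0 ≤ P x y) (hP1 : ∀ x, ∑ y, P x y = 1)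
    (hstat : ∀ y, ∑ x, μ x * P x y = μ y)
    (γ lam : ℝ) (hγ : γ ∈ Set.Ioo (0 : ℝ) 1) (hlam : lam ∈ Set.Ico (0 : ℝ) 1)
    (Ψ : Matrix (Fin NN) (Fin d) ℝ) (hΨ : Ψ.rank = d) :
    let PiG := Ψ * (Ψᵀ * Matrix.diagonal μ * Ψ)⁻¹ * Ψᵀ * Matrix.diagonal μ
    let M := ((1 - lam) * γ) •
      (P * ((1 : Matrix (Fin NN) (Fin NN) ℝ) - (lam * γ) • P)⁻¹)
    IsUnit ((1 : Matrix (Fin NN) (Fin NN) ℝ) - PiG * M) ∧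
    ∀ v : Fin NN → ℝ,
      Real.sqrt (∑ x,
          μ x * ((((1 : Matrix (Fin NN) (Fin NN) ℝ) - PiG * M)⁻¹).mulVec v x) ^ 2) ≤
        ((1 - lam * γ) / (1 - γ)) * Real.sqrt (∑ x, μ x * v x ^ 2) := by
  intro PiG M
  obtain ⟨hγ0, hγ1⟩ := hγ
  obtain ⟨hl0, hl1⟩ := hlam
  have hμ : ∀ x, 0 ≤ μ x := fun x => (hμpos x).le
  have hP := weightedNorm_stochastic_mulVec_le hμ hP0 hP1 hstat
  have hlγ0 : 0 ≤ lam * γ := by positivity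
  have hlγ1 : lam * γ < 1 := by nlinarith
  have hlγ : 0 < 1 - lam * γ := sub_pos.2 hlγ1
  have hk : 0 ≤ (1 - lam) * γ := mul_nonneg (sub_nonneg.2 hl1.le) hγ0.le
  have hresolvent := (isUnit_one_sub_and_weightedNorm_inv_mulVec_le hμpos
    (A := (lam * γ) • P) hlγ1 fun v => by
      rw [smul_mulVec, weightedNorm_smul hμ hlγ0]
      exact mul_le_mul_of_nonneg_left (hP v) hlγ0).2
  have hc : (1 - lam) * γ * (1 - lam * γ)⁻¹ < 1 := by
    rw [← div_eq_mul_inv, div_lt_one hlγ]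
    linarith
  have hA : ∀ v, weightedNorm μ ((PiG * M) *ᵥ v) ≤
      (1 - lam) * γ * (1 - lam * γ)⁻¹ * weightedNorm μ v := fun v => by
    rw [← mulVec_mulVec]
    refine (weightedNorm_projection_mulVec_le hμ (gramProjection_transpose_mul μ Ψ) _).trans ?_
    rw [smul_mulVec, weightedNorm_smul hμ hk, ← mulVec_mulVec, mul_assoc _ _ (weightedNorm μ v)]
    exact mul_le_mul_of_nonneg_left ((hP _).trans (hresolvent v)) hk
  obtain ⟨hunit, hbound⟩ := isUnit_one_sub_and_weightedNorm_inv_mulVec_le hμpos hc hA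
  refine ⟨hunit, fun v => ?_⟩
  have hconst : (1 - (1 - lam) * γ * (1 - lam * γ)⁻¹)⁻¹ = (1 - lam * γ) / (1 - γ) := by
    rw [← div_eq_mul_inv, one_sub_div hlγ.ne', inv_div]
    congr 1
    ring
  rw [← hconst]
  exact hbound v
end
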